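/- arXiv:0711.0701 — 8 statements merged into one kernel-verified Lean document; each statement's English description precedes it below -/
import Mathlib

section
/- Let p be a prime, A a commutative ring, m a natural number, and Fil : ℕ → AddSubgroup A a family of additive subgroups of A such that for all d₁, d₂ ∈ ℕ and all a ∈ Fil d₁, b ∈ Fil d₂ one has a·b ∈ Fil (d₁+d₂). For d ∈ ℕ say that a truncated Witt vector x of length m+1 over p with coefficients in A lies in Fil_d(W_m(A)) if for every i with 0 ≤ i ≤ m: x.coeff (m−i) ∈ Fil (d/p^i) whenever p^i divides d, and x.coeff (m−i) = 0 whenever p^i does not divide d. Then (a) for every d the set Fil_d(W_m(A)) is an additive subgroup of the truncated Witt vector ring (it contains 0 and is closed under addition and negation), and (b) whenever x ∈ Fil_{d₁}(W_m(A)) and y ∈ Fil_{d₂}(W_m(A)), the product x·y lies in Fil_{d₁+d₂}(W_m(A)). -/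
/-- Kato's filtration condition on truncated Witt vectors of length `m+1`:
`x` lies in `Fil_d(W_m(A))` if for every `0 ≤ i ≤ m`, the coefficient `x.coeff (m-i)`
lies in `Fil (d / p^i)` when `p^i ∣ d`, and vanishes otherwise. -/
def WittVectorFil (p : ℕ) [hp : Fact p.Prime] {A : Type*} [CommRing A] (m : ℕ)
    (Fil : ℕ → AddSubgroup A) (d : ℕ) (x : TruncatedWittVector p (m + 1) A) : Prop :=
  ∀ i : ℕ, i ≤ m →
    if p ^ i ∣ d then
      x.coeff ⟨m - i, Nat.lt_succ_of_le (Nat.sub_le m i)⟩ ∈ Fil (d / p ^ i)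
    else
      x.coeff ⟨m - i, Nat.lt_succ_of_le (Nat.sub_le m i)⟩ = 0

namespace MvPolynomial

theorem IsWeightedHomogeneous.bind₁ {σ τ R M : Type*} [CommSemiring R] [AddCommMonoid M]
    {w : σ → M} {w' : τ → M} {Φ : MvPolynomial σ R} {D : M}
    (hΦ : IsWeightedHomogeneous w Φ D) (N : ℕ) {f : σ → MvPolynomial τ R}
    (hf : ∀ i, IsWeightedHomogeneous w' (f i) (N • w i)) :
    IsWeightedHomogeneous w' (MvPolynomial.bind₁ f Φ) (N • D) := by
  rw [MvPolynomial.bind₁, aeval_def, eval₂_eq]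
  refine .sum _ _ _ fun e he => ?_
  rw [algebraMap_eq]
  refine .C_mul ?_ _
  have hD : N • D = ∑ i ∈ e.support, e i • N • w i := by
    rw [← hΦ (mem_support_iff.mp he), Finsupp.weight_apply, Finsupp.sum, Finset.smul_sum]
    exact Finset.sum_congr rfl fun i _ => smul_comm _ _ _
  rw [hD]
  exact .prod _ _ _ fun i _ => (hf i).pow _

theorem isWeightedHomogeneous_rename_wittPolynomial (p : ℕ) {idx R M : Type*} [CommRing R]
    [AddCommMonoid M] (w : idx → M) (i : idx) (n : ℕ) :
    IsWeightedHomogeneous (fun s : idx × ℕ => p ^ s.2 • w s.1)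
      (rename (Prod.mk i) (wittPolynomial p R n)) (p ^ n • w i) := by
  rw [wittPolynomial_eq_sum_C_mul_X_pow, map_sum]
  refine .sum _ _ _ fun j hj => ?_
  simp only [map_mul, map_pow, rename_X, algHom_C]
  have hw : p ^ n • w i = p ^ (n - j) • p ^ j • w i := by
    rw [← mul_smul, ← pow_add, Nat.sub_add_cancel (by grind)]
  rw [hw, algebraMap_eq, ← C_pow]
  exact .C_mul (.pow (isWeightedHomogeneous_X R (fun s : idx × ℕ => p ^ s.2 • w s.1) (i, j)) _) _

end MvPolynomial

open MvPolynomial in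
theorem isWeightedHomogeneous_wittStructureRat (p : ℕ) [Fact p.Prime] {idx M : Type*}
    [AddCommMonoid M] {w : idx → M} {Φ : MvPolynomial idx ℚ} {D : M}
    (hΦ : IsWeightedHomogeneous w Φ D) (n : ℕ) :
    IsWeightedHomogeneous (fun s : idx × ℕ => p ^ s.2 • w s.1)
      (wittStructureRat p Φ n) (p ^ n • D) := by
  induction n using Nat.strong_induction_on with
  | h n ih =>
    rw [wittStructureRat_rec]
    refine .C_mul (.sub (hΦ.bind₁ _ fun i =>
      isWeightedHomogeneous_rename_wittPolynomial p w i n) (.sum _ _ _ fun j hj => .C_mul ?_ _)) _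
    have hj : j < n := Finset.mem_range.mp hj
    have hD : p ^ n • D = p ^ (n - j) • p ^ j • D := by
      rw [← mul_smul, ← pow_add, Nat.sub_add_cancel hj.le]
    rw [hD]
    exact (ih j hj).pow _

open MvPolynomial in
theorem isWeightedHomogeneous_wittStructureInt (p : ℕ) [Fact p.Prime] {idx M : Type*}
    [AddCommMonoid M] {w : idx → M} {Φ : MvPolynomial idx ℤ} {D : M}
    (hΦ : IsWeightedHomogeneous w Φ D) (n : ℕ) :
    IsWeightedHomogeneous (fun s : idx × ℕ => p ^ s.2 • w s.1)
      (wittStructureInt p Φ n) (p ^ n • D) := by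
  have hmap : IsWeightedHomogeneous w (map (Int.castRingHom ℚ) Φ) D := fun e he =>
    hΦ fun h => he (by rw [coeff_map, h, map_zero])
  intro e he
  refine isWeightedHomogeneous_wittStructureRat p hmap n (d := e) ?_
  rw [← map_wittStructureInt, coeff_map]
  exact fun h => he (Int.cast_injective (h.trans Int.cast_zero.symm))

section MulFiltration

variable {A : Type*} [CommRing A] {Fil : ℕ → AddSubgroup A}

theorem pow_mem_filtration
    (hmul : ∀ d₁ d₂ : ℕ, ∀ a b : A, a ∈ Fil d₁ → b ∈ Fil d₂ → a * b ∈ Fil (d₁ + d₂))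
    {a : A} {c : ℕ} (ha : a ∈ Fil c) {e : ℕ} (he : e ≠ 0) : a ^ e ∈ Fil (e * c) := by
  induction e, Nat.one_le_iff_ne_zero.mpr he using Nat.le_induction with
  | base => simpa using ha
  | succ e h ih =>
    rw [pow_succ, Nat.succ_mul]
    exact hmul _ _ _ _ (ih (Nat.one_le_iff_ne_zero.mp h)) ha

theorem prod_mem_filtration
    (hmul : ∀ d₁ d₂ : ℕ, ∀ a b : A, a ∈ Fil d₁ → b ∈ Fil d₂ → a * b ∈ Fil (d₁ + d₂))
    {ι : Type*} {s : Finset ι} (hs : s.Nonempty) {f : ι → A} {c : ι → ℕ}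
    (hf : ∀ i ∈ s, f i ∈ Fil (c i)) : ∏ i ∈ s, f i ∈ Fil (∑ i ∈ s, c i) := by
  induction hs using Finset.Nonempty.cons_induction with
  | singleton i => simpa using hf
  | cons i s hi hs ih =>
    rw [Finset.prod_cons, Finset.sum_cons]
    exact hmul _ _ _ _ (hf i (by simp)) (ih fun j hj => hf j (by simp [hj]))

/-- The subgroup `Fil (d / N)`, understood as `0` when `N ∤ d`. -/
def filtrationDiv (Fil : ℕ → AddSubgroup A) (d N : ℕ) : AddSubgroup A :=
  if N ∣ d then Fil (d / N) else ⊥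

theorem filtrationDiv_mul {c N : ℕ} (hN : 0 < N) : filtrationDiv Fil (c * N) N = Fil c := by
  simp [filtrationDiv, Nat.mul_div_cancel _ hN]

theorem exists_mul_eq_of_mem_filtrationDiv {d N : ℕ} {a : A} (ha : a ∈ filtrationDiv Fil d N)
    (ha0 : a ≠ 0) : ∃ c, c * N = d ∧ a ∈ Fil c := by
  by_cases h : N ∣ d
  · rw [filtrationDiv, if_pos h] at ha
    exact ⟨d / N, Nat.div_mul_cancel h, ha⟩
  · rw [filtrationDiv, if_neg h] at ha
    exact absurd (AddSubgroup.mem_bot.mp ha) ha0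

theorem monomial_mem_filtrationDiv {p m n : ℕ} (hp : 0 < p) (hn : n ≤ m)
    (hmul : ∀ d₁ d₂ : ℕ, ∀ a b : A, a ∈ Fil d₁ → b ∈ Fil d₂ → a * b ∈ Fil (d₁ + d₂))
    {idx : Type*} {d : idx → ℕ} {D : ℕ} {x : idx × ℕ → A} {e : idx × ℕ →₀ ℕ} (he : e ≠ 0)
    (hm : ∀ s ∈ e.support, s.2 ≤ m)
    (hD : ∑ s ∈ e.support, e s * (p ^ s.2 * d s.1) = p ^ n * D)
    (hx : ∀ s ∈ e.support, x s ∈ filtrationDiv Fil (d s.1) (p ^ (m - s.2))) :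
    ∏ s ∈ e.support, x s ^ e s ∈ filtrationDiv Fil D (p ^ (m - n)) := by
  by_cases h0 : ∃ s ∈ e.support, x s = 0
  · obtain ⟨s, hs, hs0⟩ := h0
    rw [Finset.prod_eq_zero hs (by rw [hs0, zero_pow (Finsupp.mem_support_iff.mp hs)])]
    exact zero_mem _
  push Not at h0
  have hex : ∀ s, ∃ c, s ∈ e.support → c * p ^ (m - s.2) = d s.1 ∧ x s ∈ Fil c := fun s => by
    by_cases hs : s ∈ e.support
    · obtain ⟨c, hc⟩ := exists_mul_eq_of_mem_filtrationDiv (hx s hs) (h0 s hs)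
      exact ⟨c, fun _ => hc⟩
    · exact ⟨0, fun h => absurd h hs⟩
  choose c hc using hex
  have hsum : (∑ s ∈ e.support, e s * c s) * p ^ (m - n) = D := by
    refine Nat.eq_of_mul_eq_mul_left (pow_pos hp n) ?_
    rw [← hD, mul_comm, mul_assoc, ← pow_add, Nat.sub_add_cancel hn, Finset.sum_mul]
    refine Finset.sum_congr rfl fun s hs => ?_
    rw [← (hc s hs).1, ← Nat.sub_add_cancel (hm s hs), pow_add, Nat.add_sub_cancel]
    ring
  rw [← hsum, filtrationDiv_mul (pow_pos hp _)]
  exact prod_mem_filtration hmul (Finsupp.support_nonempty_iff.mpr he) fun s hs =>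
    pow_mem_filtration hmul (hc s hs).2 (Finsupp.mem_support_iff.mp hs)

open MvPolynomial in
theorem peval_wittStructureInt_mem_filtrationDiv (p : ℕ) [hp : Fact p.Prime] {m n k : ℕ}
    (hn : n ≤ m)
    (hmul : ∀ d₁ d₂ : ℕ, ∀ a b : A, a ∈ Fil d₁ → b ∈ Fil d₂ → a * b ∈ Fil (d₁ + d₂))
    {Φ : MvPolynomial (Fin k) ℤ} {d : Fin k → ℕ} {D : ℕ} (hΦ : IsWeightedHomogeneous d Φ D)
    (hΦ0 : constantCoeff Φ = 0) {x : Fin k → ℕ → A}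
    (hx : ∀ i, ∀ j ≤ m, x i j ∈ filtrationDiv Fil (d i) (p ^ (m - j))) :
    WittVector.peval (wittStructureInt p Φ n) x ∈ filtrationDiv Fil D (p ^ (m - n)) := by
  rw [WittVector.peval, aeval_def, eval₂_eq]
  refine sum_mem fun e he => ?_
  rw [eq_intCast, ← zsmul_eq_mul]
  refine zsmul_mem ?_ _
  have hm : ∀ s ∈ e.support, s.2 ≤ m := fun s hs => by
    have := wittStructureInt_vars p Φ n ((mem_vars_iff_mem_support s).mpr ⟨e, he, hs⟩)
    simp only [Finset.mem_product, Finset.mem_univ, Finset.mem_range, true_and] at this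
    omega
  refine monomial_mem_filtrationDiv hp.out.pos hn hmul (d := d) ?_ hm ?_
    fun s hs => hx s.1 s.2 (hm s hs)
  · rintro rfl
    exact mem_support_iff.mp he (constantCoeff_wittStructureInt p Φ hΦ0 n)
  · simpa [Finsupp.weight_apply, Finsupp.sum] using
      isWeightedHomogeneous_wittStructureInt p hΦ n (mem_support_iff.mp he)

theorem wittVectorFil_iff (p : ℕ) [Fact p.Prime] (m d : ℕ)
    (x : TruncatedWittVector p (m + 1) A) :
    WittVectorFil p m Fil d x ↔
      ∀ j ≤ m, x.out.coeff j ∈ filtrationDiv Fil d (p ^ (m - j)) := by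
  have key : ∀ i ≤ m, ((if p ^ i ∣ d then
      x.coeff ⟨m - i, Nat.lt_succ_of_le (Nat.sub_le m i)⟩ ∈ Fil (d / p ^ i)
    else x.coeff ⟨m - i, Nat.lt_succ_of_le (Nat.sub_le m i)⟩ = 0) ↔
      x.out.coeff (m - i) ∈ filtrationDiv Fil d (p ^ i)) := fun i _ => by
    rw [← TruncatedWittVector.coeff_out, filtrationDiv]
    split_ifs <;> simp
  constructor
  · intro h j hj
    have := (key (m - j) (Nat.sub_le m j)).mp (h _ (Nat.sub_le m j))
    rwa [Nat.sub_sub_self hj] at this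
  · intro h i hi
    refine (key i hi).mpr ?_
    have := h (m - i) (Nat.sub_le m i)
    rwa [Nat.sub_sub_self hi] at this

theorem wittVectorFil_truncateFun_iff (p : ℕ) [Fact p.Prime] (m d : ℕ) (x : WittVector p A) :
    WittVectorFil p m Fil d (WittVector.truncateFun (m + 1) x) ↔
      ∀ j ≤ m, x.coeff j ∈ filtrationDiv Fil d (p ^ (m - j)) := by
  rw [wittVectorFil_iff]
  refine forall₂_congr fun j hj => ?_
  have := TruncatedWittVector.coeff_out (WittVector.truncateFun (m + 1) x)
    ⟨j, Nat.lt_succ_of_le hj⟩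
  rw [WittVector.coeff_truncateFun] at this
  exact this ▸ Iff.rfl

end MulFiltration

/-- The filtration `Fil_d(W_m(A))` induced by a multiplicative filtration on `A`
consists of additive subgroups of the truncated Witt vector ring, and it is
multiplicative: `Fil_{d₁} · Fil_{d₂} ⊆ Fil_{d₁+d₂}`. -/
theorem wittVectorFil_isAddSubgroup_and_mul (p : ℕ) [hp : Fact p.Prime]
    {A : Type*} [CommRing A] (m : ℕ) (Fil : ℕ → AddSubgroup A)
    (hmul : ∀ d₁ d₂ : ℕ, ∀ a b : A, a ∈ Fil d₁ → b ∈ Fil d₂ → a * b ∈ Fil (d₁ + d₂)) :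
    (∀ d : ℕ,
      WittVectorFil p m Fil d 0 ∧
      (∀ x y : TruncatedWittVector p (m + 1) A,
        WittVectorFil p m Fil d x → WittVectorFil p m Fil d y →
          WittVectorFil p m Fil d (x + y)) ∧
      (∀ x : TruncatedWittVector p (m + 1) A,
        WittVectorFil p m Fil d x → WittVectorFil p m Fil d (-x))) ∧
    (∀ d₁ d₂ : ℕ, ∀ x y : TruncatedWittVector p (m + 1) A,
      WittVectorFil p m Fil d₁ x → WittVectorFil p m Fil d₂ y →
        WittVectorFil p m Fil (d₁ + d₂) (x * y)) := by
  open MvPolynomial in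
  refine ⟨fun d => ⟨?_, fun x y hx hy => ?_, fun x hx => ?_⟩, fun d₁ d₂ x y hx hy => ?_⟩
  · rw [← WittVector.truncateFun_zero, wittVectorFil_truncateFun_iff]
    exact fun j _ => by rw [WittVector.zero_coeff]; exact zero_mem _
  · rw [wittVectorFil_iff] at hx hy
    rw [← x.truncateFun_out, ← y.truncateFun_out, ← WittVector.truncateFun_add,
      wittVectorFil_truncateFun_iff]
    intro n hn
    rw [WittVector.add_coeff]
    refine peval_wittStructureInt_mem_filtrationDiv p hn hmul (d := ![d, d])
      (.add (isWeightedHomogeneous_X ℤ ![d, d] 0) (isWeightedHomogeneous_X ℤ ![d, d] 1))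
      (by simp) ?_
    intro i; fin_cases i
    exacts [hx, hy]
  · rw [wittVectorFil_iff] at hx
    rw [← x.truncateFun_out, ← WittVector.truncateFun_neg, wittVectorFil_truncateFun_iff]
    intro n hn
    rw [WittVector.neg_coeff]
    refine peval_wittStructureInt_mem_filtrationDiv p hn hmul (d := ![d])
      (isWeightedHomogeneous_X ℤ ![d] 0).neg (by simp) ?_
    intro i; fin_cases i
    exact hx
  · rw [wittVectorFil_iff] at hx hy
    rw [← x.truncateFun_out, ← y.truncateFun_out, ← WittVector.truncateFun_mul,
      wittVectorFil_truncateFun_iff]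
    intro n hn
    rw [WittVector.mul_coeff]
    refine peval_wittStructureInt_mem_filtrationDiv p hn hmul (d := ![d₁, d₂])
      (.mul (isWeightedHomogeneous_X ℤ ![d₁, d₂] 0) (isWeightedHomogeneous_X ℤ ![d₁, d₂] 1))
      (by simp) ?_
    intro i; fin_cases i
    exacts [hx, hy]
end

section
/- Let p be a prime and n a natural number. The Witt addition polynomial wittAdd p n, an element of MvPolynomial (Fin 2 × ℕ) ℤ, is weighted homogeneous of weighted degree p^n with respect to the weight function assigning to the variable (b, k) the weight p^k; that is, every monomial occurring in wittAdd p n with nonzero coefficient has total weighted degree exactly p^n. -/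
open MvPolynomial in
theorem MvPolynomial.IsWeightedHomogeneous.of_map {σ R S M : Type*} [CommSemiring R]
    [CommSemiring S] [AddCommMonoid M] {w : σ → M} {f : R →+* S} (hf : Function.Injective f)
    {φ : MvPolynomial σ R} {m : M} (h : IsWeightedHomogeneous w (map f φ) m) :
    IsWeightedHomogeneous w φ m := by
  intro d hd
  apply h
  rw [coeff_map]
  exact (map_ne_zero_iff f hf).mpr hd

open MvPolynomial in
/-- A sum of terms `C (p ^ i) * φ i ^ p ^ (n - i)`, where `φ i` has weighted degree `p ^ i`. -/
theorem MvPolynomial.IsWeightedHomogeneous.sum_C_mul_pow {σ R : Type*} [CommSemiring R]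
    {w : σ → ℕ} {p n : ℕ} {s : Finset ℕ} {φ : ℕ → MvPolynomial σ R} (hs : ∀ i ∈ s, i ≤ n)
    (h : ∀ i ∈ s, IsWeightedHomogeneous w (φ i) (p ^ i)) :
    IsWeightedHomogeneous w (∑ i ∈ s, C ((p : R) ^ i) * φ i ^ p ^ (n - i)) (p ^ n) := by
  refine IsWeightedHomogeneous.sum s _ _ fun i hi => ?_
  have key := ((h i hi).pow (p ^ (n - i))).C_mul ((p : R) ^ i)
  rwa [smul_eq_mul, ← pow_add, Nat.sub_add_cancel (hs i hi)] at key

open MvPolynomial in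
theorem wittPolynomial_rename_isWeightedHomogeneous {idx R : Type*} [CommRing R] (p n : ℕ)
    (b : idx) :
    IsWeightedHomogeneous (fun bk : idx × ℕ => p ^ bk.2)
      (rename (Prod.mk b) (wittPolynomial p R n)) (p ^ n) := by
  simp only [wittPolynomial_eq_sum_C_mul_X_pow, map_sum, map_mul, map_pow, rename_C, rename_X]
  simp only [← map_pow]
  exact IsWeightedHomogeneous.sum_C_mul_pow
    (fun i hi => Nat.lt_succ_iff.mp (Finset.mem_range.mp hi))
    fun i _ => isWeightedHomogeneous_X R _ (b, i)

open MvPolynomial in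
theorem wittStructureRat_isWeightedHomogeneous {idx : Type*} (p : ℕ) [Fact p.Prime]
    {Φ : MvPolynomial idx ℚ}
    (hΦ : ∀ n, IsWeightedHomogeneous (fun bk : idx × ℕ => p ^ bk.2)
      (bind₁ (fun b => rename (Prod.mk b) (wittPolynomial p ℚ n)) Φ) (p ^ n)) (n : ℕ) :
    IsWeightedHomogeneous (fun bk : idx × ℕ => p ^ bk.2) (wittStructureRat p Φ n) (p ^ n) := by
  induction n using Nat.strong_induction_on with
  | h n ih =>
    rw [wittStructureRat_rec]
    exact ((hΦ n).sub (IsWeightedHomogeneous.sum_C_mul_pow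
      (fun i hi => (Finset.mem_range.mp hi).le) fun i hi => ih i (Finset.mem_range.mp hi))).C_mul _

/-- The Witt addition polynomial `wittAdd p n ∈ ℤ[(b,k) : Fin 2 × ℕ]` is weighted
homogeneous of weighted degree `p^n` for the weights `w(b, k) = p^k`. -/
theorem wittAdd_isWeightedHomogeneous (p : ℕ) [hp : Fact p.Prime] (n : ℕ) :
    MvPolynomial.IsWeightedHomogeneous (fun bk : Fin 2 × ℕ => p ^ bk.2)
      (WittVector.wittAdd p n) (p ^ n) := by
  apply MvPolynomial.IsWeightedHomogeneous.of_map (f := Int.castRingHom ℚ) Int.cast_injective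
  rw [WittVector.wittAdd, map_wittStructureInt]
  refine wittStructureRat_isWeightedHomogeneous p (fun m => ?_) n
  simp only [map_add, MvPolynomial.map_X, MvPolynomial.bind₁_X_right]
  exact (wittPolynomial_rename_isWeightedHomogeneous p m 0).add
    (wittPolynomial_rename_isWeightedHomogeneous p m 1)
end

section
/- Let p be a prime and n a natural number. The Witt multiplication polynomial wittMul p n, an element of MvPolynomial (Fin 2 × ℕ) ℤ, is weighted homogeneous of weighted degree p^n with respect to the weight function assigning to the variable (0, k) the weight p^k and to every variable (1, k) the weight 0; and it is also weighted homogeneous of weighted degree p^n with respect to the weight function assigning to the variable (1, k) the weight p^k and to every variable (0, k) the weight 0. In other words, every monomial occurring in wittMul p n has weighted degree p^n computed on the first group of variables and, simultaneously, weighted degree p^n computed on the second group of variables. -/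
namespace MvPolynomial

theorem IsWeightedHomogeneous.of_C_mul {σ R M : Type*} [CommSemiring R] [NoZeroDivisors R]
    [AddCommMonoid M] {w : σ → M} {φ : MvPolynomial σ R} {m : M} {r : R} (hr : r ≠ 0)
    (h : IsWeightedHomogeneous w (C r * φ) m) : IsWeightedHomogeneous w φ m := fun d hd =>
  h (by rw [coeff_C_mul]; exact mul_ne_zero hr hd)

end MvPolynomial

open MvPolynomial

theorem wittPolynomial_rename_isWeightedHomogeneous_s7 {σ R : Type*} [CommRing R] (p : ℕ)
    {w : σ → ℕ} {f : ℕ → σ} {d : ℕ} (hw : ∀ k, w (f k) = d * p ^ k) (n : ℕ) :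
    IsWeightedHomogeneous w (rename f (wittPolynomial p R n)) (d * p ^ n) := by
  rw [wittPolynomial_eq_sum_C_mul_X_pow, map_sum]
  refine IsWeightedHomogeneous.sum _ _ _ fun i hi => ?_
  simp only [map_mul (rename f), map_pow (rename f), rename_C, rename_X]
  refine IsWeightedHomogeneous.C_mul ?_ _
  convert! (isWeightedHomogeneous_X R w (f i)).pow (p ^ (n - i)) using 1
  rw [hw, smul_eq_mul, mul_left_comm, ← pow_add,
    Nat.sub_add_cancel (Nat.lt_succ_iff.mp (Finset.mem_range.mp hi))]

theorem wittStructureInt_isWeightedHomogeneous {idx : Type*} (p : ℕ) [hp : Fact p.Prime]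
    {Φ : MvPolynomial idx ℤ} {w : idx × ℕ → ℕ} {d : ℕ}
    (h : ∀ n, IsWeightedHomogeneous w
      (bind₁ (fun i => rename (Prod.mk i) (wittPolynomial p ℤ n)) Φ) (d * p ^ n)) (n : ℕ) :
    IsWeightedHomogeneous w (wittStructureInt p Φ n) (d * p ^ n) := by
  induction n using Nat.strong_induction_on with
  | h n ih =>
    have hn := h n
    rw [← wittStructureInt_prop, wittPolynomial_eq_sum_C_mul_X_pow, map_sum,
      Finset.sum_range_succ] at hn
    simp only [map_mul, map_pow _ (X _), bind₁_C_right, bind₁_X_right, tsub_self, pow_zero,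
      pow_one] at hn
    refine IsWeightedHomogeneous.of_C_mul
      (pow_ne_zero n (Nat.cast_ne_zero.mpr hp.out.ne_zero)) ?_
    rw [← add_sub_cancel_left (∑ i ∈ Finset.range n, _) (C _ * _)]
    refine hn.sub (IsWeightedHomogeneous.sum _ _ _ fun i hi => ?_)
    have hi := Finset.mem_range.mp hi
    refine IsWeightedHomogeneous.C_mul ?_ _
    convert! (ih i hi).pow (p ^ (n - i)) using 1
    rw [smul_eq_mul, mul_left_comm, ← pow_add, Nat.sub_add_cancel hi.le]

theorem wittMul_isWeightedHomogeneous_of_weights (p : ℕ) [Fact p.Prime] {w : Fin 2 × ℕ → ℕ}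
    {a b : ℕ} (h₀ : ∀ k, w (0, k) = a * p ^ k) (h₁ : ∀ k, w (1, k) = b * p ^ k) (n : ℕ) :
    IsWeightedHomogeneous w (WittVector.wittMul p n) ((a + b) * p ^ n) := by
  refine wittStructureInt_isWeightedHomogeneous p (fun n => ?_) n
  rw [map_mul, bind₁_X_right, bind₁_X_right, add_mul]
  exact (wittPolynomial_rename_isWeightedHomogeneous_s7 p h₀ n).mul
    (wittPolynomial_rename_isWeightedHomogeneous_s7 p h₁ n)


/-- The Witt multiplication polynomial `wittMul p n ∈ ℤ[(b,k) : Fin 2 × ℕ]` is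
weighted homogeneous of weighted degree `p^n` both for the weights
`w(0, k) = p^k`, `w(1, k) = 0` and for the weights `w(0, k) = 0`, `w(1, k) = p^k`:
it is bihomogeneous of bidegree `(p^n, p^n)` in the two groups of variables. -/
theorem wittMul_isWeightedHomogeneous (p : ℕ) [hp : Fact p.Prime] (n : ℕ) :
    MvPolynomial.IsWeightedHomogeneous
      (fun bk : Fin 2 × ℕ => if bk.1 = 0 then p ^ bk.2 else 0)
      (WittVector.wittMul p n) (p ^ n) ∧
    MvPolynomial.IsWeightedHomogeneous
      (fun bk : Fin 2 × ℕ => if bk.1 = 1 then p ^ bk.2 else 0)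
      (WittVector.wittMul p n) (p ^ n) := by
  constructor
  · simpa using wittMul_isWeightedHomogeneous_of_weights p (a := 1) (b := 0)
      (w := fun bk => if bk.1 = 0 then p ^ bk.2 else 0) (by simp) (by simp) n
  · simpa using wittMul_isWeightedHomogeneous_of_weights p (a := 0) (b := 1)
      (w := fun bk => if bk.1 = 1 then p ^ bk.2 else 0) (by simp) (by simp) n
end

section
/- Let p be a prime and R a commutative ring of characteristic p. For a Witt vector x ∈ 𝕎(R), the following are equivalent: (i) there exists y ∈ 𝕎(R) with x = p • y (i.e. x lies in p·𝕎(R)); (ii) x.coeff 0 = 0 and for every n ≥ 1 there exists a ∈ R with x.coeff n = a^p. -/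
/-- Over a commutative ring `R` of characteristic `p`, a `p`-typical Witt vector `x`
lies in `p·𝕎(R)` if and only if its zeroth coefficient vanishes and all its higher
coefficients are `p`-th powers in `R`. -/
theorem wittVector_mem_p_smul_iff (p : ℕ) [hp : Fact p.Prime]
    {R : Type*} [CommRing R] [CharP R p] (x : WittVector p R) :
    (∃ y : WittVector p R, x = p • y) ↔
      (x.coeff 0 = 0 ∧ ∀ n : ℕ, 1 ≤ n → ∃ a : R, x.coeff n = a ^ p) := by
  have smul_eq (y : WittVector p R) : p • y = y * p := by rw [nsmul_eq_mul, mul_comm]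
  simp only [smul_eq]
  constructor
  · rintro ⟨y, rfl⟩
    refine ⟨WittVector.mul_charP_coeff_zero y, fun n hn => ?_⟩
    obtain ⟨m, rfl⟩ := Nat.exists_eq_add_of_le' hn
    exact ⟨y.coeff m, WittVector.mul_charP_coeff_succ y m⟩
  · rintro ⟨h0, h⟩
    choose a ha using fun n : ℕ => h (n + 1) n.succ_pos
    refine ⟨WittVector.mk p a, ?_⟩
    ext ⟨n⟩
    · rw [h0, WittVector.mul_charP_coeff_zero]
    · rw [WittVector.mul_charP_coeff_succ, WittVector.coeff_mk, ha]
end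

section
/- Let p be a prime, k a field of characteristic p, and k' an additive subgroup of k such that every element a ∈ k can be written uniquely as a = b^p + c with b ∈ k and c ∈ k'. Then for every m ∈ ℕ and every truncated Witt vector x of length m+1 over p with coefficients in k, there exists exactly one truncated Witt vector y of length m+1 such that y.coeff i ∈ k' for all i with 1 ≤ i ≤ m (no condition on y.coeff 0) and x − y ∈ p·W_m(k), i.e. there exists z with x = y + p • z. -/
namespace WittVector

section CommRing

variable {p : ℕ} [hp : Fact p.Prime] {R : Type*} [CommRing R]

theorem sub_coeff_zero (x y : WittVector p R) : (x - y).coeff 0 = x.coeff 0 - y.coeff 0 :=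
  map_sub constantCoeff x y

theorem init_add_iterate_verschiebung_shift (x : WittVector p R) (n : ℕ) :
    init n x + verschiebung^[n] (x.shift n) = x := by
  have htail : verschiebung^[n] (x.shift n) = tail n x := by
    ext i
    simp only [tail, select, coeff_mk]
    split_ifs with hi
    · obtain ⟨j, rfl⟩ := Nat.exists_eq_add_of_le' hi
      rw [iterate_verschiebung_coeff, shift_coeff, add_comm]
    · exact iterate_verschiebung_coeff_eq_zero _ (not_le.mp hi)
  rw [htail, init_add_tail]

/-- If two Witt vectors agree below position `n`, then the `n`-th coefficient of their difference
is the difference of their `n`-th coefficients. -/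
theorem coeff_sub_of_agree_below {x y : WittVector p R} {n : ℕ}
    (h : ∀ i < n, x.coeff i = y.coeff i) :
    (x - y).coeff n = x.coeff n - y.coeff n := by
  have hinit : init n x = init n y := by
    ext i
    simp only [init, select, coeff_mk]
    split_ifs with hi
    exacts [h i hi, rfl]
  have hsub : x - y = verschiebung^[n] (x.shift n - y.shift n) := by
    rw [iterate_map_sub]
    nth_rewrite 1 [← init_add_iterate_verschiebung_shift x n,
      ← init_add_iterate_verschiebung_shift y n, hinit]
    abel
  have hcoeff := iterate_verschiebung_coeff (x.shift n - y.shift n) n 0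
  rw [zero_add, ← hsub, sub_coeff_zero, shift_coeff, shift_coeff, add_zero] at hcoeff
  exact hcoeff

end CommRing

variable {p : ℕ} [hp : Fact p.Prime] {k : Type*} [CommRing k] [CharP k p]

theorem iterate_verschiebung_mul_charP (x : WittVector p k) (n : ℕ) :
    verschiebung^[n] x * p = verschiebung^[n + 1] (frobenius x) := by
  rw [iterate_verschiebung_mul_left, Function.iterate_succ_apply, verschiebung_frobenius,
    Function.iterate_fixed (map_natCast frobenius p)]

/-- If every element of `k` is the sum of a `p`-th power and an element of `k'`, then modulo `p` and
`V^(n+1)` every Witt vector has a representative whose coefficients in positive positions lie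
in `k'`. -/
theorem exists_eq_add_mul_charP_add_iterate_verschiebung (k' : AddSubgroup k)
    (hk' : ∀ a : k, ∃ b : k, ∃ c ∈ k', a = b ^ p + c) (x : WittVector p k) (n : ℕ) :
    ∃ y z r : WittVector p k, (∀ i, 1 ≤ i → y.coeff i ∈ k') ∧ (∀ i, n < i → y.coeff i = 0) ∧
      x = y + z * p + verschiebung^[n + 1] r := by
  induction n with
  | zero =>
    refine ⟨teichmuller p (x.coeff 0), 0, (x - teichmuller p (x.coeff 0)).shift 1,
      fun i hi ↦ ?_, fun i hi ↦ teichmuller_coeff_pos p _ i hi, ?_⟩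
    · rw [teichmuller_coeff_pos p _ i hi]
      exact k'.zero_mem
    · rw [zero_add, ← eq_iterate_verschiebung (n := 1)]
      · ring
      · intro i hi
        rw [Nat.lt_one_iff.mp hi, sub_coeff_zero, teichmuller_coeff_zero, sub_self]
  | succ n ih =>
    obtain ⟨y, z, r, hy, hy0, hx⟩ := ih
    obtain ⟨b, c, hc, hr⟩ := hk' (r.coeff 0)
    set s := r - teichmuller p c - frobenius (teichmuller p b) with hs
    have hs0 : s.coeff 0 = 0 := by
      rw [hs, sub_coeff_zero, sub_coeff_zero, coeff_frobenius_charP, teichmuller_coeff_zero,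
        teichmuller_coeff_zero, hr]
      ring
    have hsV : s = verschiebung (s.shift 1) :=
      eq_iterate_verschiebung (n := 1) fun i hi ↦ by rw [Nat.lt_one_iff.mp hi, hs0]
    have hV (i : ℕ) (hi : i ≠ n + 1) :
        (verschiebung^[n + 1] (teichmuller p c)).coeff i = 0 := by
      rcases hi.lt_or_gt with hi | hi
      · exact iterate_verschiebung_coeff_eq_zero _ hi
      · obtain ⟨j, rfl⟩ := Nat.exists_eq_add_of_le' hi.le
        rw [iterate_verschiebung_coeff, teichmuller_coeff_pos p c j (by lia)]
    have hV' : (verschiebung^[n + 1] (teichmuller p c)).coeff (n + 1) = c := by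
      simpa using iterate_verschiebung_coeff (teichmuller p c) (n + 1) 0
    have hadd (i : ℕ) : (y + verschiebung^[n + 1] (teichmuller p c)).coeff i =
        y.coeff i + (verschiebung^[n + 1] (teichmuller p c)).coeff i := by
      apply coeff_add_of_disjoint
      intro j
      by_cases hj : j = n + 1
      · exact .inl (hy0 j (by lia))
      · exact .inr (hV j hj)
    refine ⟨y + verschiebung^[n + 1] (teichmuller p c), z + verschiebung^[n] (teichmuller p b),
      s.shift 1, fun i hi ↦ ?_, fun i hi ↦ ?_, ?_⟩
    · rw [hadd]
      refine k'.add_mem (hy i hi) ?_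
      by_cases hj : i = n + 1
      · rwa [hj, hV']
      · rw [hV i hj]
        exact k'.zero_mem
    · rw [hadd, hy0 i (by lia), hV i (by lia), add_zero]
    · rw [Function.iterate_succ_apply _ (n + 1), ← hsV, hs, iterate_map_sub, iterate_map_sub,
        add_mul, iterate_verschiebung_mul_charP, hx]
      ring

end WittVector


/-- Let `k` be a field of characteristic `p` and `k'` an additive subgroup of `k`
giving an internal decomposition `k = k^p ⊕ k'` (every `a ∈ k` is uniquely
`a = b^p + c` with `b ∈ k`, `c ∈ k'`). Then every truncated Witt vector
`x ∈ W_m(k)` has a unique representative `y` modulo `p·W_m(k)` whose coefficients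
in positions `1, …, m` all lie in `k'`. -/
theorem truncatedWittVector_unique_repr_mod_p (p : ℕ) [hp : Fact p.Prime]
    {k : Type*} [Field k] [CharP k p] (k' : AddSubgroup k)
    (hk' : ∀ a : k, ∃! bc : k × k', a = bc.1 ^ p + (bc.2 : k))
    (m : ℕ) (x : TruncatedWittVector p (m + 1) k) :
    ∃! y : TruncatedWittVector p (m + 1) k,
      (∀ i : Fin (m + 1), 1 ≤ (i : ℕ) → y.coeff i ∈ k') ∧
      ∃ z : TruncatedWittVector p (m + 1) k, x = y + p • z := by
  have mem_ker_of_iterate (r : WittVector p k) :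
      WittVector.truncate (m + 1) (WittVector.verschiebung^[m + 1] r) = 0 :=
    (WittVector.mem_ker_truncate _ _).mpr fun _ hi ↦
      WittVector.iterate_verschiebung_coeff_eq_zero _ hi
  obtain ⟨X, rfl⟩ := WittVector.truncate_surjective p (m + 1) k x
  obtain ⟨Y, Z, r, hY, -, hX⟩ :=
    WittVector.exists_eq_add_mul_charP_add_iterate_verschiebung k' (fun a ↦ by
      obtain ⟨⟨b, c⟩, h, -⟩ := hk' a
      exact ⟨b, c, c.2, h⟩) X m
  refine ⟨WittVector.truncate (m + 1) Y, ⟨fun i hi ↦ ?_, WittVector.truncate (m + 1) Z, ?_⟩, ?_⟩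
  · rw [WittVector.coeff_truncate]
    exact hY i hi
  · rw [hX, map_add, map_add, mem_ker_of_iterate, map_mul, map_natCast, nsmul_eq_mul, add_zero,
      mul_comm]
  · rintro y' ⟨hy', z', hz'⟩
    obtain ⟨Y', rfl⟩ := WittVector.truncate_surjective p (m + 1) k y'
    obtain ⟨Z', rfl⟩ := WittVector.truncate_surjective p (m + 1) k z'
    have hdiff : WittVector.truncate (m + 1) (Y' - Y) =
        WittVector.truncate (m + 1) ((Z - Z') * (p : WittVector p k)) := by
      rw [hX, map_add, map_add, mem_ker_of_iterate, map_mul, map_natCast, nsmul_eq_mul] at hz'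
      rw [map_sub, map_mul, map_sub, map_natCast]
      linear_combination -hz'
    have hcoeff (i : ℕ) (hi : i < m + 1) : Y'.coeff i = Y.coeff i := by
      induction i using Nat.strong_induction_on with
      | _ i ih =>
        have hsub := WittVector.coeff_sub_of_agree_below fun j hj ↦ ih j hj (hj.trans hi)
        have hi' := congr_arg (TruncatedWittVector.coeff ⟨i, hi⟩) hdiff
        rw [WittVector.coeff_truncate, WittVector.coeff_truncate, hsub] at hi'
        cases i with
        | zero => rwa [WittVector.mul_charP_coeff_zero, sub_eq_zero] at hi'
        | succ j =>
          rw [WittVector.mul_charP_coeff_succ] at hi'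
          have hmem := hy' ⟨j + 1, hi⟩ (by simp)
          rw [WittVector.coeff_truncate] at hmem
          have huniq := (hk' (Y'.coeff (j + 1))).unique
            (y₁ := (0, ⟨Y'.coeff (j + 1), hmem⟩))
            (y₂ := ((Z - Z').coeff j, ⟨Y.coeff (j + 1), hY _ (by simp)⟩))
            (by simp [hp.out.ne_zero]) (by rw [← hi']; simp)
          exact congr_arg (fun bc : k × k' ↦ (bc.2 : k)) huniq
    ext i
    rw [WittVector.coeff_truncate, WittVector.coeff_truncate, hcoeff i i.2]
end

section
/- Let p be a prime, k a field of characteristic p, m a natural number, and λ_0, λ_1, …, λ_m elements of k. Let d : k → Ω¹_{k/𝔽_p} denote the universal derivation into the module of Kähler differentials of k over its prime field 𝔽_p. Then the equality λ_0^{p^m − 1}·d(λ_0) + λ_1^{p^{m−1} − 1}·d(λ_1) + ⋯ + λ_{m−1}^{p − 1}·d(λ_{m−1}) + d(λ_m) = 0 holds in Ω¹_{k/𝔽_p} if and only if every λ_j (0 ≤ j ≤ m) is a p-th power in k, i.e. for each j there exists μ_j ∈ k with λ_j = μ_j^p. -/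
section

open Polynomial

/-- In characteristic `p`, the `p`-th power of the inner derivation `[T, ·]` is `[T ^ p, ·]`. -/
theorem commutator_pow_char (p : ℕ) [Fact p.Prime] {A : Type*} [Ring A] [Nontrivial A]
    [Algebra (ZMod p) A] (T a : A) :
    ((LinearMap.mulLeft (ZMod p) T - LinearMap.mulRight (ZMod p) T) ^ p) a
      = T ^ p * a - a * T ^ p := by
  have : CharP (Module.End (ZMod p) A) p :=
    charP_of_injective_algebraMap (algebraMap (ZMod p) (Module.End (ZMod p) A)).injective p
  rw [sub_pow_char_of_commute _ (LinearMap.commute_mulLeft_right _ _),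
    LinearMap.pow_mulLeft, LinearMap.pow_mulRight]
  simp

namespace Derivation

variable {p : ℕ} [Fact p.Prime]

theorem commutator_pow_mulLeft {R A : Type*} [CommRing R] [CommRing A] [Algebra R A]
    (D : Derivation R A A) (n : ℕ) (b : A) :
    ((LinearMap.mulLeft R (D : Module.End R A) - LinearMap.mulRight R (D : Module.End R A)) ^ n)
      (LinearMap.mulLeft R b) = LinearMap.mulLeft R (((D : Module.End R A) ^ n) b) := by
  induction n with
  | zero => simp
  | succ n ih =>
    rw [pow_succ', Module.End.mul_apply, ih]
    ext x
    simp [pow_succ', mul_comm]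

/-- The `p`-th iterate of a derivation in characteristic `p` is a derivation. -/
def powChar {A : Type*} [CommRing A] [Nontrivial A] [Algebra (ZMod p) A]
    (D : Derivation (ZMod p) A A) : Derivation (ZMod p) A A :=
  Derivation.mk' ((D : Module.End (ZMod p) A) ^ p) fun a b => by
    have h := commutator_pow_char p (D : Module.End (ZMod p) A) (LinearMap.mulLeft (ZMod p) a)
    rw [commutator_pow_mulLeft] at h
    have h := LinearMap.congr_fun h b
    simp only [LinearMap.mulLeft_apply, LinearMap.sub_apply, Module.End.mul_apply] at h
    rw [smul_eq_mul, smul_eq_mul, mul_comm b, h]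
    ring

theorem powChar_apply {A : Type*} [CommRing A] [Nontrivial A] [Algebra (ZMod p) A]
    (D : Derivation (ZMod p) A A) (a : A) :
    D.powChar a = ((D : Module.End (ZMod p) A) ^ p) a := rfl

variable {k : Type*} [Field k] [Algebra (ZMod p) k] (D : Derivation (ZMod p) k k)

/-- The extension of a derivation to polynomials, acting on coefficients. -/
noncomputable def polynomialCoeffs : Derivation (ZMod p) k[X] k[X] :=
  PolynomialModule.equivPolynomialSelf.compDer D.mapCoeffs

theorem coeff_polynomialCoeffs (f : k[X]) (i : ℕ) :
    (D.polynomialCoeffs f).coeff i = D (f.coeff i) := rfl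

theorem polynomialCoeffs_C (a : k) : D.polynomialCoeffs (C a) = C (D a) := by
  ext i
  rw [coeff_polynomialCoeffs, coeff_C, coeff_C]
  split_ifs <;> simp

theorem derivative_polynomialCoeffs (f : k[X]) :
    derivative (D.polynomialCoeffs f) = D.polynomialCoeffs (derivative f) := by
  ext i
  simp only [coeff_polynomialCoeffs, coeff_derivative, leibniz, map_add, map_natCast,
    map_one_eq_zero, smul_eq_mul]
  simp [mul_comm]

/-- The operator `D + t u` on `k[t]`. -/
noncomputable def twist (u : k) : Module.End (ZMod p) k[X] :=
  (D.polynomialCoeffs : Module.End (ZMod p) k[X]) + LinearMap.mulLeft (ZMod p) (C u * X)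

theorem twist_apply (u : k) (f : k[X]) :
    D.twist u f = D.polynomialCoeffs f + C u * X * f := rfl

theorem commutator_twist_pow_mulLeft_C (u g : k) (n : ℕ) :
    ((LinearMap.mulLeft (ZMod p) (D.twist u) - LinearMap.mulRight (ZMod p) (D.twist u)) ^ n)
      (LinearMap.mulLeft (ZMod p) (C g))
      = LinearMap.mulLeft (ZMod p) (C (((D : Module.End (ZMod p) k) ^ n) g)) := by
  induction n with
  | zero => simp
  | succ n ih =>
    rw [pow_succ', Module.End.mul_apply, ih]
    refine LinearMap.ext fun f => ?_
    simp only [LinearMap.sub_apply, LinearMap.mulLeft_apply, LinearMap.mulRight_apply,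
      Module.End.mul_apply, twist_apply, leibniz, polynomialCoeffs_C, smul_eq_mul, pow_succ',
      coeFn_coe]
    ring

theorem derivative_twist_pow_char (u : k) :
    derivative (((D.twist u) ^ p) 1) = C (((D : Module.End (ZMod p) k) ^ (p - 1)) u) := by
  set d : Module.End (ZMod p) k[X] := (derivative : k[X] →ₗ[k] k[X]).restrictScalars (ZMod p)
  have h1 : (LinearMap.mulLeft (ZMod p) (D.twist u) - LinearMap.mulRight (ZMod p) (D.twist u)) d
      = - LinearMap.mulLeft (ZMod p) (C u) := by
    refine LinearMap.ext fun f => ?_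
    simp only [d, LinearMap.sub_apply, LinearMap.mulLeft_apply, LinearMap.mulRight_apply,
      Module.End.mul_apply, twist_apply, LinearMap.coe_restrictScalars, map_add,
      derivative_polynomialCoeffs, derivative_mul, derivative_C, derivative_X, LinearMap.neg_apply]
    ring
  have h := commutator_pow_char p (D.twist u) d
  rw [← pow_sub_one_mul (Fact.out : p.Prime).ne_zero, Module.End.mul_apply, h1, map_neg,
    commutator_twist_pow_mulLeft_C] at h
  have h := LinearMap.congr_fun h 1
  simpa [d] using h.symm

theorem natDegree_twist_pow_le (u : k) (n : ℕ) : (((D.twist u) ^ n) 1).natDegree ≤ n := by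
  induction n with
  | zero => simp
  | succ n ih =>
    rw [pow_succ', Module.End.mul_apply, natDegree_le_iff_coeff_eq_zero]
    intro i hi
    rw [natDegree_le_iff_coeff_eq_zero] at ih
    obtain ⟨i, rfl⟩ := Nat.exists_eq_succ_of_ne_zero (by omega : i ≠ 0)
    rw [twist_apply, coeff_add, coeff_polynomialCoeffs, mul_assoc, coeff_C_mul,
      Nat.succ_eq_add_one, coeff_X_mul, ih _ (by omega), ih _ (by omega)]
    simp

theorem coeff_twist_pow_self (u : k) (n : ℕ) : (((D.twist u) ^ n) 1).coeff n = u ^ n := by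
  induction n with
  | zero => simp
  | succ n ih =>
    have h := natDegree_le_iff_coeff_eq_zero.1 (D.natDegree_twist_pow_le u n) (n + 1) (by omega)
    rw [pow_succ', Module.End.mul_apply, twist_apply, coeff_add, coeff_polynomialCoeffs, mul_assoc,
      coeff_C_mul, coeff_X_mul, ih, h, map_zero, zero_add, pow_succ']

theorem coeff_twist_pow_succ_zero (u : k) (n : ℕ) :
    (((D.twist u) ^ (n + 1)) 1).coeff 0 = 0 := by
  induction n with
  | zero => simp [twist_apply]
  | succ n ih =>
    rw [pow_succ', Module.End.mul_apply, twist_apply, coeff_add, coeff_polynomialCoeffs, ih]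
    simp [mul_assoc]

theorem twist_pow_char (u : k) :
    ((D.twist u) ^ p) 1
      = C (((D : Module.End (ZMod p) k) ^ (p - 1)) u) * X + C (u ^ p) * X ^ p := by
  have : CharP k p := charP_of_injective_algebraMap (algebraMap (ZMod p) k).injective p
  have hp := (Fact.out : p.Prime).two_le
  ext i
  have hd := congrArg (fun f => f.coeff (i - 1)) (D.derivative_twist_pow_char u)
  simp only [coeff_derivative, coeff_C] at hd
  rcases Nat.lt_trichotomy i p with hi | rfl | hi
  · obtain rfl | hi0 := Nat.eq_zero_or_pos i
    · obtain ⟨n, rfl⟩ : ∃ n, p = n + 1 := ⟨p - 1, by omega⟩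
      rw [coeff_twist_pow_succ_zero]
      simp
    · obtain ⟨i, rfl⟩ : ∃ j, i = j + 1 := ⟨i - 1, by omega⟩
      rw [Nat.add_sub_cancel] at hd
      have hne : (i + 1 : k) ≠ 0 := by
        have := (CharP.cast_eq_zero_iff k p (i + 1)).not.2 (Nat.not_dvd_of_pos_of_lt hi0 hi)
        exact_mod_cast this
      simp only [coeff_add, coeff_C_mul, coeff_X_pow, coeff_X, if_neg hi.ne, mul_zero, add_zero]
      rcases Nat.eq_zero_or_pos i with rfl | hi1
      · simpa using hd
      · rw [if_neg (by omega), mul_eq_zero] at hd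
        rw [if_neg (by omega), mul_zero]
        exact hd.resolve_right hne
  · rw [coeff_twist_pow_self]
    simp [coeff_X, show ¬ 1 = i by omega, -map_pow]
  · rw [natDegree_le_iff_coeff_eq_zero.1 (D.natDegree_twist_pow_le u p) i hi]
    simp [coeff_X, coeff_X_pow, show ¬ 1 = i by omega, hi.ne', -map_pow]

theorem eval_one_polynomialCoeffs (f : k[X]) :
    (D.polynomialCoeffs f).eval 1 = D (f.eval 1) := by
  have h : (D.polynomialCoeffs f).natDegree < f.natDegree + 1 := by
    rw [Nat.lt_succ_iff, natDegree_le_iff_coeff_eq_zero]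
    intro i hi
    rw [coeff_polynomialCoeffs, coeff_eq_zero_of_natDegree_lt hi, map_zero]
  rw [eval_eq_sum_range' h, eval_eq_sum_range, map_sum]
  simp [coeff_polynomialCoeffs]

theorem eval_one_twist_pow (x : k) (hx : x ≠ 0) (n : ℕ) :
    x * (((D.twist (D x / x)) ^ n) 1).eval 1 = ((D : Module.End (ZMod p) k) ^ n) x := by
  induction n with
  | zero => simp
  | succ n ih =>
    rw [pow_succ', pow_succ', Module.End.mul_apply, Module.End.mul_apply, ← ih, twist_apply,
      coeFn_coe, leibniz, eval_add, eval_one_polynomialCoeffs]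
    simp
    field_simp

theorem pow_apply_pow_char_mul (n : ℕ) (a x : k) :
    ((D : Module.End (ZMod p) k) ^ n) (a ^ p * x)
      = a ^ p * ((D : Module.End (ZMod p) k) ^ n) x := by
  have : CharP k p := charP_of_injective_algebraMap (algebraMap (ZMod p) k).injective p
  induction n with
  | zero => simp
  | succ n ih =>
    rw [pow_succ', Module.End.mul_apply, ih, Module.End.mul_apply, coeFn_coe, leibniz,
      leibniz_pow]
    simp

/-- Hochschild's formula. -/
theorem pow_pred_apply_pow_pred_mul (x : k) :
    ((D : Module.End (ZMod p) k) ^ (p - 1)) (x ^ (p - 1) * D x)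
      = x ^ (p - 1) * D.powChar x - D x ^ p := by
  have hp := (Fact.out : p.Prime).two_le
  obtain rfl | hx := eq_or_ne x 0
  · simp [show p ≠ 0 by omega]
  have h := D.eval_one_twist_pow x hx p
  rw [twist_pow_char] at h
  rw [powChar_apply, ← h]
  have hx' : x ^ (p - 1) * D x = x ^ p * (D x / x) := by
    rw [← pow_sub_one_mul (by omega : p ≠ 0) x]
    field_simp
  rw [hx', pow_apply_pow_char_mul]
  simp only [eval_add, eval_mul, eval_C, eval_X, mul_one, eval_pow, one_pow, div_pow]
  rw [← mul_assoc, ← pow_succ, Nat.sub_add_cancel (by omega)]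
  field_simp
  ring

end Derivation

end

section

open scoped IntermediateField

/-- Over a subfield of characteristic `p`, adjoining a `p`-th root outside the subfield of an element
gives an extension of degree `p`. -/
theorem Subfield.finrank_adjoin_simple_of_pow_mem {p : ℕ} [Fact p.Prime] {k : Type*} [Field k]
    [CharP k p] (F : Subfield k) {b : k} (hb : b ∉ F) (hbp : b ^ p ∈ F) :
    Module.finrank F F⟮b⟯ = p := by
  have hp : p.Prime := Fact.out
  have hirr : Irreducible (Polynomial.X ^ p - Polynomial.C (⟨b ^ p, hbp⟩ : F)) := by
    refine X_pow_sub_C_irreducible_of_prime hp fun c hc => hb ?_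
    have : (c : k) ^ p = b ^ p := by simpa using congrArg Subtype.val hc
    rw [← frobenius_inj k p this]
    exact c.2
  have hmin := minpoly.eq_of_irreducible_of_monic hirr
    (show Polynomial.aeval b _ = 0 by simp [Algebra.algebraMap_ofSubsemiring_apply])
    (Polynomial.monic_X_pow_sub_C _ hp.ne_zero)
  rw [IntermediateField.adjoin.finrank
    ⟨_, Polynomial.monic_X_pow_sub_C (⟨b ^ p, hbp⟩ : F) hp.ne_zero, by
      simp [Algebra.algebraMap_ofSubsemiring_apply]⟩, ← hmin, Polynomial.natDegree_X_pow_sub_C]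

theorem Subfield.exists_maximal_notMem {k : Type*} [Field k] (K : Subfield k) {a : k}
    (ha : a ∉ K) : ∃ F, K ≤ F ∧ Maximal (fun F : Subfield k => a ∉ F) F := by
  refine zorn_le_nonempty₀ {F : Subfield k | a ∉ F} (fun c hc hchain y hy => ?_) K ha
  refine ⟨sSup c, fun h => ?_, fun z hz => le_sSup hz⟩
  obtain ⟨s, hs, has⟩ := (Subfield.mem_sSup_of_directedOn ⟨y, hy⟩ hchain.directedOn).1 h
  exact hc hs has

/-- In characteristic `p`, an element with zero differential is a `p`-th power. -/
theorem KaehlerDifferential.exists_eq_pow_of_D_eq_zero (p : ℕ) [Fact p.Prime] {k : Type*} [Field k]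
    [CharP k p] [Algebra (ZMod p) k] {a : k} (ha : KaehlerDifferential.D (ZMod p) k a = 0) :
    ∃ μ : k, a = μ ^ p := by
  have hp : p.Prime := Fact.out
  by_contra! hne
  obtain ⟨F, hKF, haF, hmax⟩ := (frobenius k p).fieldRange.exists_maximal_notMem (a := a)
    (by rintro ⟨μ, rfl⟩; exact hne μ rfl)
  have hpow (x : k) : x ^ p ∈ F := hKF ⟨x, rfl⟩
  have hfin {x : k} (hx : x ∉ F) := F.finrank_adjoin_simple_of_pow_mem hx (hpow x)
  have htop : F⟮a⟯ = ⊤ := by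
    refine top_unique fun b _ => ?_
    by_cases hb : b ∈ F
    · exact F⟮a⟯.algebraMap_mem ⟨b, hb⟩
    have hab : a ∈ F⟮b⟯ := by
      by_contra hab
      refine hb (hmax (y := F⟮b⟯.toSubfield) hab (fun x hx => F⟮b⟯.algebraMap_mem ⟨x, hx⟩) ?_)
      exact IntermediateField.mem_adjoin_simple_self F b
    have : FiniteDimensional F F⟮b⟯ := .of_finrank_pos (by rw [hfin hb]; exact hp.pos)
    rw [IntermediateField.eq_of_le_of_finrank_eq
      (IntermediateField.adjoin_simple_le_iff.2 hab) (by rw [hfin hb, hfin haF])]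
    exact IntermediateField.mem_adjoin_simple_self F b
  have : FiniteDimensional F k := .of_finrank_pos <| by
    rw [← IntermediateField.finrank_top', ← htop, hfin haF]; exact hp.pos
  let _ : Algebra (ZMod p) F := ZMod.algebra F p
  have : @IsScalarTower (ZMod p) F k Algebra.toSMul Algebra.toSMul Algebra.toSMul :=
      .of_algebraMap_eq' (Subsingleton.elim _ _)
  have hDa : KaehlerDifferential.D F k a = 0 := by
    simpa [ha] using (KaehlerDifferential.map_D (ZMod p) F k k a).symm
  have hD : KaehlerDifferential.D F k = 0 := by
    refine Derivation.ext_of_adjoin_eq_top {a} ?_ (by simpa using hDa)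
    rw [← IntermediateField.adjoin_simple_toSubalgebra_of_isAlgebraic
      (Algebra.IsAlgebraic.isAlgebraic a), htop, IntermediateField.top_toSubalgebra]
  have : Algebra.FormallyUnramified F k := by
    refine ⟨(Submodule.subsingleton_iff k).1 (subsingleton_of_bot_eq_top ?_)⟩
    rw [← KaehlerDifferential.span_range_derivation, hD, eq_comm, Submodule.span_eq_bot]
    rintro _ ⟨x, rfl⟩
    rfl
  have : Algebra.IsSeparable F k := Algebra.FormallyUnramified.isSeparable F k
  have : IsPurelyInseparable F k := (isPurelyInseparable_iff_pow_mem F p).2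
    fun x => ⟨1, ⟨x ^ p, hpow x⟩, by simp [Algebra.algebraMap_ofSubsemiring_apply]⟩
  obtain ⟨x, rfl⟩ := IsPurelyInseparable.surjective_algebraMap_of_isSeparable F k a
  exact haF x.2

end

/-- The inverse Cartier operator is injective modulo exact forms: if
`∑ a_i ^ p * b_i ^ (p - 1) d b_i` is exact, then `∑ a_i d b_i = 0`. -/
theorem KaehlerDifferential.sum_smul_D_eq_zero_of_sum_pow_smul_D_add_D_eq_zero
    (p : ℕ) [Fact p.Prime] {k : Type*} [Field k] [Algebra (ZMod p) k]
    {ι : Type*} (s : Finset ι) (a b : ι → k) (c : k)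
    (h : ∑ i ∈ s, (a i ^ p * b i ^ (p - 1)) • KaehlerDifferential.D (ZMod p) k (b i)
      + KaehlerDifferential.D (ZMod p) k c = 0) :
    ∑ i ∈ s, a i • KaehlerDifferential.D (ZMod p) k (b i) = 0 := by
  have hp : p.Prime := Fact.out
  have : CharP k p := charP_of_injective_algebraMap (algebraMap (ZMod p) k).injective p
  rw [← Module.forall_dual_apply_eq_zero_iff k]
  intro φ
  set D : Derivation (ZMod p) k k := φ.compDer (KaehlerDifferential.D (ZMod p) k)
  have key (E : Derivation (ZMod p) k k) :
      ∑ i ∈ s, a i ^ p * (b i ^ (p - 1) * E (b i)) + E c = 0 := by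
    simpa [mul_assoc] using congrArg E.liftKaehlerDifferential h
  have h1 := congrArg ((D : Module.End (ZMod p) k) ^ (p - 1)) (key D)
  simp only [map_add, map_sum, D.pow_apply_pow_char_mul, D.pow_pred_apply_pow_pred_mul,
    map_zero] at h1
  have h2 : ((D : Module.End (ZMod p) k) ^ (p - 1)) (D c) = D.powChar c := by
    rw [Derivation.powChar_apply, ← pow_sub_one_mul hp.ne_zero]
    rfl
  rw [h2] at h1
  have h3 := key D.powChar
  have h4 : (∑ i ∈ s, a i * D (b i)) ^ p = 0 := by
    simp only [sum_pow_char, mul_pow]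
    rw [← sub_self (0 : k)]
    nth_rw 1 [← h3]
    rw [← h1, add_sub_add_right_eq_sub, ← Finset.sum_sub_distrib]
    exact Finset.sum_congr rfl fun i _ => by ring
  simpa [D] using eq_zero_of_pow_eq_zero h4


/-- (Cartier operator lemma.) Let `k` be a field of characteristic `p` and
`λ_0, …, λ_m ∈ k`. Then
`λ_0^{p^m-1}·d(λ_0) + λ_1^{p^{m-1}-1}·d(λ_1) + ⋯ + λ_{m-1}^{p-1}·d(λ_{m-1}) + d(λ_m) = 0`
in `Ω¹_{k/𝔽_p}` if and only if every `λ_j` is a `p`-th power in `k`. -/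
theorem sum_pow_smul_d_eq_zero_iff_pow_p (p : ℕ) [hp : Fact p.Prime]
    {k : Type*} [Field k] [CharP k p] [Algebra (ZMod p) k]
    (m : ℕ) (lam : ℕ → k) :
    (∑ j ∈ Finset.range (m + 1),
        lam j ^ (p ^ (m - j) - 1) • (KaehlerDifferential.D (ZMod p) k) (lam j)) = 0 ↔
      ∀ j : ℕ, j ≤ m → ∃ μ : k, lam j = μ ^ p := by
  have hD (x : k) : KaehlerDifferential.D (ZMod p) k (x ^ p) = 0 := by
    rw [Derivation.leibniz_pow, ← Nat.cast_smul_eq_nsmul k]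
    simp
  constructor
  · induction m with
    | zero =>
      intro h j hj
      obtain rfl : j = 0 := by omega
      exact KaehlerDifferential.exists_eq_pow_of_D_eq_zero p (by simpa using h)
    | succ m ih =>
      intro h
      rw [Finset.sum_range_succ] at h
      have hlow : ∀ j ≤ m, ∃ μ : k, lam j = μ ^ p := by
        refine ih (KaehlerDifferential.sum_smul_D_eq_zero_of_sum_pow_smul_D_add_D_eq_zero p _ _ _
          (lam (m + 1)) ?_)
        convert h using 2
        · refine Finset.sum_congr rfl fun j hj => ?_
          congr 1
          have hj : j < m + 1 := Finset.mem_range.1 hj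
          rw [← pow_mul, ← pow_add, show m + 1 - j = m - j + 1 by omega, pow_succ, Nat.sub_mul]
          have h1 : 1 ≤ p := hp.out.one_le
          have h2 : p ≤ p ^ (m - j) * p := Nat.le_mul_of_pos_left p (by positivity)
          congr 1
          omega
        · simp
      intro j hj
      rcases hj.lt_or_eq with hj | rfl
      · exact hlow j (by omega)
      · rw [Finset.sum_eq_zero, zero_add] at h
        · exact KaehlerDifferential.exists_eq_pow_of_D_eq_zero p (by simpa using h)
        · intro j hj
          obtain ⟨μ, hμ⟩ := hlow j (by simpa [Nat.lt_succ_iff] using hj)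
          rw [hμ, hD, smul_zero]
  · intro h
    refine Finset.sum_eq_zero fun j hj => ?_
    obtain ⟨μ, hμ⟩ := h j (by simpa [Nat.lt_succ_iff] using hj)
    rw [hμ, hD, smul_zero]
end

section
/- Let G be a group and let I and H be subgroups of G such that I is normal in G and G is the internal semidirect product of I and H (that is, I ⊓ H is trivial and I and H together generate G, so that every element of G is uniquely a product of an element of I and an element of H). Then the abelianization of G is a direct product of a quotient of the abelianization of I with the abelianization of H: there exists a subgroup N of Abelianization(I) and a group isomorphism Abelianization(G) ≅ (Abelianization(I) / N) × Abelianization(H). -/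
/-- If a normal subgroup `I` has a complement `H`, then `G` retracts onto `H` with `I` in the kernel. -/
theorem Subgroup.IsComplement'.exists_retraction {G : Type*} [Group G] {I H : Subgroup G}
    [I.Normal] (h : I.IsComplement' H) :
    ∃ r : G →* H, (∀ i : I, r i = 1) ∧ ∀ k : H, r k = k := by
  refine ⟨(h.symm.QuotientMulEquiv : G ⧸ I →* H).comp (QuotientGroup.mk' I), fun i ↦ ?_,
    fun k ↦ ?_⟩
  · have : QuotientGroup.mk' I (i : G) = 1 := (QuotientGroup.eq_one_iff _).2 i.2
    rw [MonoidHom.comp_apply, this, map_one]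
  · exact h.symm.QuotientMulEquiv.apply_symm_apply k

/-- If a group `G` is an internal semidirect product of a normal subgroup `I` and a
subgroup `H`, then the abelianization of `G` is a direct product of a quotient of
the abelianization of `I` with the abelianization of `H`. -/
theorem abelianization_of_semidirect_product {G : Type*} [Group G]
    (I H : Subgroup G) (hI : I.Normal) (hinf : I ⊓ H = ⊥) (hsup : I ⊔ H = ⊤) :
    ∃ N : Subgroup (Abelianization ↥I),
      Nonempty (Abelianization G ≃* (Abelianization ↥I ⧸ N) × Abelianization ↥H) := by
  have hdecomp (g : G) : ∃ i ∈ I, ∃ k ∈ H, i * k = g :=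
    Subgroup.mem_sup_of_normal_left.1 (hsup ▸ Subgroup.mem_top g)
  have hc : I.IsComplement' H := by
    refine Subgroup.isComplement'_of_disjoint_and_mul_eq_univ (disjoint_iff.2 hinf)
      (Set.eq_univ_of_forall fun g ↦ ?_)
    obtain ⟨i, hi, k, hk, rfl⟩ := hdecomp g
    exact Set.mul_mem_mul hi hk
  obtain ⟨r, hrI, hrH⟩ := hc.exists_retraction
  let f := Abelianization.map I.subtype
  let s := Abelianization.map H.subtype
  let ρ := Abelianization.map r
  have hρf (x : Abelianization I) : ρ (f x) = 1 := by
    obtain ⟨i, rfl⟩ := QuotientGroup.mk_surjective x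
    exact congrArg Abelianization.of (hrI i)
  have hρs (y : Abelianization H) : ρ (s y) = y := by
    obtain ⟨k, rfl⟩ := QuotientGroup.mk_surjective y
    exact congrArg Abelianization.of (hrH k)
  let Φ : (Abelianization I ⧸ f.ker) × Abelianization H →* Abelianization G :=
    (QuotientGroup.kerLift f).coprod s
  refine ⟨f.ker, ⟨(MulEquiv.ofBijective Φ ⟨?_, fun z ↦ ?_⟩).symm⟩⟩
  · refine (injective_iff_map_eq_one Φ).2 ?_
    rintro ⟨x, y⟩ hxy
    obtain ⟨x, rfl⟩ := QuotientGroup.mk_surjective x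
    have hxy' : f x * s y = 1 := hxy
    have hy : y = 1 := by
      have := congrArg ρ hxy'
      rwa [map_mul, hρf, hρs, one_mul, map_one] at this
    subst hy
    rw [map_one, mul_one] at hxy'
    exact Prod.ext ((QuotientGroup.eq_one_iff x).2 hxy') rfl
  · obtain ⟨g, rfl⟩ := QuotientGroup.mk_surjective z
    obtain ⟨i, hi, k, hk, rfl⟩ := hdecomp g
    exact ⟨(QuotientGroup.mk (Abelianization.of ⟨i, hi⟩), Abelianization.of ⟨k, hk⟩), rfl⟩
end

section
/- Let F be a field equipped with a multiplicative nonarchimedean norm ‖·‖ (so ‖x·y‖ = ‖x‖·‖y‖, ‖x‖ = 0 iff x = 0, and ‖x + y‖ ≤ max(‖x‖, ‖y‖)). Let ∂ : F → F be an additive map satisfying the Leibniz rule ∂(a·b) = a·∂(b) + b·∂(a), and let C ∈ ℝ be such that ‖∂(f)‖ ≤ C·‖f‖ for all f ∈ F. Fix g ∈ F with C < ‖g‖, and define the sequence g_1 := g and g_{n+1} := ∂(g_n) + g_n·g for n ≥ 1. Then for every n ≥ 1 one has ‖g_n‖ = ‖g‖^n. -/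
/-- A nonnegative multiplicative function on a field is even. -/
theorem multiplicative_norm_neg {F : Type*} [Field F] (nrm : F → ℝ)
    (hnonneg : ∀ x : F, 0 ≤ nrm x) (hmul : ∀ x y : F, nrm (x * y) = nrm x * nrm y) (x : F) :
    nrm (-x) = nrm x := by
  have h : nrm (-x) * nrm (-x) = nrm x * nrm x := by
    rw [← hmul, ← hmul, neg_mul_neg]
  exact (mul_self_inj (hnonneg _) (hnonneg _)).1 h

/-- For a multiplicative nonarchimedean norm, the strictly larger summand determines the norm
of a sum. -/
theorem nonarchimedean_norm_add_eq_right {F : Type*} [Field F] (nrm : F → ℝ)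
    (hnonneg : ∀ x : F, 0 ≤ nrm x) (hmul : ∀ x y : F, nrm (x * y) = nrm x * nrm y)
    (hnonarch : ∀ x y : F, nrm (x + y) ≤ max (nrm x) (nrm y)) {a b : F}
    (hab : nrm a < nrm b) : nrm (a + b) = nrm b := by
  refine le_antisymm ((hnonarch a b).trans (max_le hab.le le_rfl)) ?_
  have h := hnonarch (-a) (a + b)
  rw [neg_add_cancel_left, multiplicative_norm_neg nrm hnonneg hmul] at h
  exact (le_max_iff.1 h).resolve_left hab.not_ge

/-- Sub-lemma of the Small Radius Lemma (small radius regime): if `F` is a field with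
a multiplicative nonarchimedean norm, `∂` is a derivation on `F` with
`‖∂ f‖ ≤ C ‖f‖`, `C < ‖g‖`, and `g_1 = g`, `g_{n+1} = ∂(g_n) + g_n·g`, then
`‖g_n‖ = ‖g‖^n` for all `n ≥ 1`. -/
theorem norm_iterated_connection_eq_of_small_radius {F : Type*} [Field F]
    (nrm : F → ℝ) (hnonneg : ∀ x : F, 0 ≤ nrm x)
    (hmul : ∀ x y : F, nrm (x * y) = nrm x * nrm y)
    (hzero : ∀ x : F, nrm x = 0 ↔ x = 0)
    (hnonarch : ∀ x y : F, nrm (x + y) ≤ max (nrm x) (nrm y))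
    (der : F → F) (hadd : ∀ a b : F, der (a + b) = der a + der b)
    (hleib : ∀ a b : F, der (a * b) = a * der b + b * der a)
    (C : ℝ) (hC : ∀ f : F, nrm (der f) ≤ C * nrm f)
    (g : F) (hg : C < nrm g) (gs : ℕ → F) (hgs1 : gs 1 = g)
    (hgsrec : ∀ n : ℕ, 1 ≤ n → gs (n + 1) = der (gs n) + gs n * g) :
    ∀ n : ℕ, 1 ≤ n → nrm (gs n) = nrm g ^ n := by
  have h_one : 0 < nrm 1 := (hnonneg 1).lt_of_ne' fun h => one_ne_zero ((hzero 1).1 h)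
  have hC_nonneg : 0 ≤ C := nonneg_of_mul_nonneg_left ((hnonneg _).trans (hC 1)) h_one
  have hg_pos : 0 < nrm g := hC_nonneg.trans_lt hg
  intro n hn
  induction n, hn using Nat.le_induction with
  | base => rw [hgs1, pow_one]
  | succ n hn ih =>
    have h_pos : 0 < nrm (gs n) := ih ▸ pow_pos hg_pos n
    have h_lt : nrm (der (gs n)) < nrm (gs n * g) := by
      rw [hmul, mul_comm]
      exact (hC _).trans_lt (mul_lt_mul_of_pos_right hg h_pos)
    rw [hgsrec n hn, nonarchimedean_norm_add_eq_right nrm hnonneg hmul hnonarch h_lt, hmul, ih,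
      pow_succ]
end
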